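/- For every real number ε > 0 and every natural number n, the function φ_{n,ε} : ℝ → ℝ defined by φ_{n,ε}(x) = x − ρ_ε(x − n) is infinitely differentiable, strictly increasing and strictly concave; it satisfies φ_{n,ε}(x) ≤ x for all x, and |φ_{n,ε}(x) − min(x, n)| ≤ ε for all real x (a bound uniform in both n and x). -/

import Mathlib

theorem abs_lt_sqrt_sq_add_sq {ε : ℝ} (hε : 0 < ε) (u : ℝ) : |u| < √(u ^ 2 + ε ^ 2) := by
  apply Real.lt_sqrt_of_sq_lt
  rw [sq_abs]
  linarith [pow_pos hε 2]

theorem sqrt_sq_add_sq_le_abs_add {ε : ℝ} (hε : 0 ≤ ε) (u : ℝ) : √(u ^ 2 + ε ^ 2) ≤ |u| + ε := by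
  apply Real.sqrt_le_iff.2 ⟨by positivity, ?_⟩
  nlinarith [sq_abs u, mul_nonneg (abs_nonneg u) hε]

theorem sqrt_sq_add_sq_sub_lt {ε : ℝ} (hε : 0 < ε) {u v : ℝ} (huv : u < v) :
    √(v ^ 2 + ε ^ 2) < √(u ^ 2 + ε ^ 2) + (v - u) := by
  have hu := (le_abs_self u).trans_lt (abs_lt_sqrt_sq_add_sq hε u)
  have hs : √(u ^ 2 + ε ^ 2) ^ 2 = u ^ 2 + ε ^ 2 := Real.sq_sqrt (by positivity)
  rw [Real.sqrt_lt' (add_pos_of_nonneg_of_pos (Real.sqrt_nonneg _) (sub_pos.2 huv))]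
  nlinarith [mul_pos (sub_pos.2 huv) (sub_pos.2 hu)]

theorem strictConvexOn_sqrt_sq_add_sq {ε : ℝ} (hε : 0 < ε) :
    StrictConvexOn ℝ Set.univ (fun u : ℝ => √(u ^ 2 + ε ^ 2)) := by
  refine ⟨convex_univ, fun u _ v _ huv a b ha hb hab => ?_⟩
  have hs : √(u ^ 2 + ε ^ 2) ^ 2 = u ^ 2 + ε ^ 2 := Real.sq_sqrt (by positivity)
  have ht : √(v ^ 2 + ε ^ 2) ^ 2 = v ^ 2 + ε ^ 2 := Real.sq_sqrt (by positivity)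
  have hcs : u * v + ε ^ 2 < √(u ^ 2 + ε ^ 2) * √(v ^ 2 + ε ^ 2) := by
    rw [← Real.sqrt_mul (by positivity)]
    apply Real.lt_sqrt_of_sq_lt
    have := mul_pos (pow_pos hε 2) (pow_pos (abs_pos.2 (sub_ne_zero.2 huv)) 2)
    rw [sq_abs] at this
    linarith
  have hpos : 0 < a * √(u ^ 2 + ε ^ 2) + b * √(v ^ 2 + ε ^ 2) := by positivity
  simp only [smul_eq_mul]
  rw [Real.sqrt_lt' hpos]
  obtain rfl : b = 1 - a := by linarith
  linear_combination 2 * mul_lt_mul_of_pos_left hcs (mul_pos ha hb) - a ^ 2 * hs - (1 - a) ^ 2 * ht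

/-- Properties of `φ_{n,ε}(x) = x − ρ_ε(x − n)` where `ρ_ε(y) = (y + √(y² + ε²))/2`:
it is `C^∞`, strictly increasing, strictly concave, bounded above by the identity,
and within `ε` of `min(x, n)`, uniformly in `n` and `x`. -/
theorem phi_n_eps_properties (ε : ℝ) (hε : 0 < ε) (n : ℕ) :
    ContDiff ℝ (⊤ : ℕ∞)
      (fun x : ℝ => x - ((x - n) + Real.sqrt ((x - n) ^ 2 + ε ^ 2)) / 2) ∧
    StrictMono
      (fun x : ℝ => x - ((x - n) + Real.sqrt ((x - n) ^ 2 + ε ^ 2)) / 2) ∧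
    StrictConcaveOn ℝ Set.univ
      (fun x : ℝ => x - ((x - n) + Real.sqrt ((x - n) ^ 2 + ε ^ 2)) / 2) ∧
    (∀ x : ℝ, x - ((x - n) + Real.sqrt ((x - n) ^ 2 + ε ^ 2)) / 2 ≤ x) ∧
    (∀ x : ℝ,
      |(x - ((x - n) + Real.sqrt ((x - n) ^ 2 + ε ^ 2)) / 2) - min x n| ≤ ε) := by
  refine ⟨?_, fun x y hxy => ?_, ⟨convex_univ, fun x _ y _ hxy a b ha hb hab => ?_⟩,
    fun x => ?_, fun x => ?_⟩
  · have h : ContDiff ℝ (⊤ : ℕ∞) (fun x : ℝ => √((x - n) ^ 2 + ε ^ 2)) :=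
      ContDiff.sqrt (by fun_prop) (fun x => by positivity)
    fun_prop
  · have := sqrt_sq_add_sq_sub_lt hε (sub_lt_sub_right hxy (n : ℝ))
    simp only
    linarith
  · have h := (strictConvexOn_sqrt_sq_add_sq hε).2 (Set.mem_univ (x - (n : ℝ)))
      (Set.mem_univ (y - (n : ℝ))) (fun h => hxy (sub_left_injective h)) ha hb hab
    obtain rfl : b = 1 - a := by linarith
    simp only [smul_eq_mul] at h ⊢
    rw [show a * (x - n) + (1 - a) * (y - n) = a * x + (1 - a) * y - n by ring] at h
    linarith
  · linarith [neg_le_abs (x - n), abs_lt_sqrt_sq_add_sq hε (x - n)]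
  · have h₁ := abs_lt_sqrt_sq_add_sq hε (x - n)
    have h₂ := sqrt_sq_add_sq_le_abs_add hε.le (x - n)
    have h₃ := max_sub_min_eq_abs' x (n : ℝ)
    have h₄ := max_add_min x (n : ℝ)
    rw [abs_le]
    constructor <;> linarith
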